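/- arXiv:1804.07158 — 3 statements merged into one kernel-verified Lean document; each statement's English description precedes it below -/
import Mathlib

section
/- Let L be a first-order language and let A and B be finite L-structures. If h : A → B and g : B → A are injective homomorphisms, then h is an isomorphism; in particular A and B are isomorphic L-structures. -/
open FirstOrder FirstOrder.Language

/-- Iterates of an endomorphism of a structure are endomorphisms. -/
theorem FirstOrder.Language.Hom.exists_coe_eq_iterate {L : FirstOrder.Language} {M : Type*}
    [L.Structure M] (f : M →[L] M) (n : ℕ) : ∃ k : M →[L] M, ⇑k = f^[n] := by
  induction n with
  | zero => exact ⟨Hom.id L M, rfl⟩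
  | succ n ih =>
    obtain ⟨k, hk⟩ := ih
    exact ⟨k.comp f, by rw [Function.iterate_succ, ← hk]; rfl⟩

/-- An injective endomorphism of a finite structure has a left inverse endomorphism. -/
theorem FirstOrder.Language.Hom.exists_leftInverse_of_injective {L : FirstOrder.Language}
    {M : Type*} [L.Structure M] [Finite M] (f : M →[L] M) (hf : Function.Injective f) :
    ∃ k : M →[L] M, Function.LeftInverse k f := by
  let e : Equiv.Perm M := Equiv.ofBijective f (Finite.injective_iff_bijective.mp hf)
  obtain ⟨n, hn, he⟩ := (isOfFinOrder_of_finite e).exists_pow_eq_one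
  obtain ⟨m, rfl⟩ := Nat.exists_eq_succ_of_ne_zero hn.ne'
  obtain ⟨k, hk⟩ := f.exists_coe_eq_iterate m
  refine ⟨k, fun x => ?_⟩
  have h := DFunLike.congr_fun he x
  rw [← Equiv.Perm.iterate_eq_pow] at h
  rw [hk]
  exact h

/-- If `A` and `B` are finite `L`-structures and `h : A → B`, `g : B → A` are injective
homomorphisms, then `h` is an isomorphism (it has a two-sided homomorphism inverse);
in particular `A` and `B` are isomorphic `L`-structures. -/
theorem stmt_0 {L : FirstOrder.Language} {A B : Type*} [L.Structure A] [L.Structure B]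
    [Finite A] [Finite B] (h : A →[L] B) (g : B →[L] A)
    (hh : Function.Injective h) (hg : Function.Injective g) :
    (∃ h' : B →[L] A, h'.comp h = Hom.id L A ∧ h.comp h' = Hom.id L B) ∧
      Nonempty (A ≃[L] B) := by
  have hinj : Function.Injective (g.comp h) := hg.comp hh
  obtain ⟨k, hk⟩ := (g.comp h).exists_leftInverse_of_injective hinj
  have hleft : Function.LeftInverse (k.comp g) h := hk
  have hsurj : Function.Surjective h := fun b => by
    obtain ⟨a, ha⟩ := Finite.surjective_of_injective hinj (g b)
    exact ⟨a, hg ha⟩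
  have hright : Function.RightInverse (k.comp g) h := hleft.rightInverse_of_surjective hsurj
  refine ⟨⟨k.comp g, Hom.ext hleft, Hom.ext hright⟩, ⟨?_⟩⟩
  exact
    { toFun := h
      invFun := k.comp g
      left_inv := hleft
      right_inv := hright
      map_fun' := h.map_fun
      map_rel' := fun r x => ⟨fun hr => by
        have hx := (k.comp g).map_rel r _ hr
        rwa [← Function.comp_assoc, hleft.comp_eq_id, Function.id_comp] at hx, h.map_rel r x⟩ }
end

section
/- Let L be a first-order language and let A be a finite L-structure. Then A has a core: there exist a substructure S of A and a homomorphism r : A → S that fixes every element of S, such that every endomorphism of S (with its induced L-structure) is injective. -/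
open FirstOrder FirstOrder.Language

namespace FirstOrder.Language.Hom

variable {L : FirstOrder.Language} {A : Type*} [L.Structure A]

/-- Every iterate of an endomorphism is an endomorphism. -/
theorem exists_coe_eq_iterate_s7 (e : A →[L] A) (n : ℕ) :
    ∃ g : A →[L] A, ⇑g = e^[n] := by
  induction n with
  | zero => exact ⟨Hom.id L A, rfl⟩
  | succ n ih =>
    obtain ⟨g, hg⟩ := ih
    exact ⟨g.comp e, by rw [Function.iterate_succ, ← hg]; rfl⟩

/-- Every structure has an endomorphism whose range has the least possible `ncard`. -/
theorem exists_ncard_range_le (L : FirstOrder.Language) (A : Type*) [L.Structure A] :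
    ∃ e : A →[L] A, ∀ f : A →[L] A, (Set.range e).ncard ≤ (Set.range f).ncard := by
  obtain ⟨e, -, he⟩ := (measure fun e : A →[L] A => (Set.range e).ncard).wf.has_min
    Set.univ ⟨Hom.id L A, trivial⟩
  exact ⟨e, fun f => not_lt.1 (he f trivial)⟩

end FirstOrder.Language.Hom

/-- A self-map that permutes a finite set has a positive iterate fixing that set pointwise. -/
theorem Set.BijOn.exists_pos_iterate_eq {α : Type*} {f : α → α} {s : Set α} (hs : s.Finite)
    (hf : Set.BijOn f s s) : ∃ n, 0 < n ∧ ∀ x ∈ s, f^[n] x = x := by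
  have : Finite s := hs
  let σ : Equiv.Perm s := hf.equiv f
  refine ⟨orderOf σ, orderOf_pos σ, fun x hx => ?_⟩
  have hσ (n : ℕ) : ((σ ^ n) ⟨x, hx⟩ : α) = f^[n] x := by
    induction n with
    | zero => rfl
    | succ n ih => rw [pow_succ', Function.iterate_succ_apply', ← ih]; rfl
  rw [← hσ, pow_orderOf_eq_one]
  rfl

/-- Every finite `L`-structure `A` has a core: there are a substructure `S` of `A` and a
homomorphism `r : A → S` fixing `S` pointwise, such that every endomorphism of `S` (with
its induced `L`-structure) is injective. -/
theorem stmt_7 {L : FirstOrder.Language} {A : Type*} [L.Structure A] [Finite A] :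
    ∃ (S : L.Substructure A) (r : A →[L] S),
      (∀ x : S, r (x : A) = x) ∧ ∀ h : S →[L] S, Function.Injective h := by
  obtain ⟨e, he⟩ := Hom.exists_ncard_range_le L A
  have range_eq (f : A →[L] A) (hf : Set.range f ⊆ Set.range e) : Set.range f = Set.range e :=
    Set.eq_of_subset_of_ncard_le hf (he f)
  have surj : Set.SurjOn e (Set.range e) (Set.range e) := by
    have h := range_eq (e.comp e) (by rintro _ ⟨x, rfl⟩; exact ⟨e x, rfl⟩)
    rintro y hy
    rw [← h] at hy
    obtain ⟨x, rfl⟩ := hy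
    exact ⟨e x, ⟨x, rfl⟩, rfl⟩
  have maps : Set.MapsTo e (Set.range e) (Set.range e) := fun x _ => ⟨x, rfl⟩
  have bij : Set.BijOn e (Set.range e) (Set.range e) :=
    ⟨maps, ((Set.toFinite _).surjOn_iff_bijOn_of_mapsTo maps |>.1 surj).injOn, surj⟩
  obtain ⟨n, hn, hfix⟩ := bij.exists_pos_iterate_eq (Set.toFinite _)
  obtain ⟨g, hg⟩ := e.exists_coe_eq_iterate_s7 n
  have hgmem (x : A) : g x ∈ e.range := by
    obtain ⟨m, rfl⟩ := Nat.exists_eq_succ_of_ne_zero hn.ne'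
    rw [hg, Function.iterate_succ_apply']
    exact ⟨_, rfl⟩
  let r : A →[L] e.range := g.codRestrict e.range hgmem
  refine ⟨e.range, r, fun x => Subtype.ext ?_, fun h => Finite.injective_iff_surjective.2 ?_⟩
  · change g x = x
    rw [hg]
    exact hfix x x.2
  · intro y
    have hrange := range_eq ((e.range.subtype.toHom.comp h).comp r)
      (by rintro _ ⟨x, rfl⟩; exact (h (r x)).2)
    have hy : (y : A) ∈ Set.range e := y.2
    rw [← hrange] at hy
    obtain ⟨x, hx⟩ := hy
    exact ⟨r x, Subtype.ext hx⟩
end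

section
/- There exist a first-order language L (with two unary relation symbols P and Q), an L-theory T (with the two axioms ∃x P(x) and ∃x Q(x)), and a finite model A of T such that A is i-minimal for T (every injective homomorphism from a model of T into A is an isomorphism) but A is not a-minimal for T: there is a model B of T with a homomorphism B → A but no homomorphism A → B. Concretely, A is the one-element structure whose element satisfies both P and Q, and B is the two-element structure with one element satisfying only P and the other satisfying only Q. -/
open FirstOrder FirstOrder.Language

/-- The language with no function symbols and two unary relation symbols `P` and `Q`
(encoded as the two elements of `Bool`: `P := true`, `Q := false`). -/
def L13 : FirstOrder.Language :=
  ⟨fun _ => Empty, fun n => match n with | 1 => Bool | _ => Empty⟩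

/-- The relation symbol `P`. -/
def P13 : L13.Relations 1 := true

/-- The relation symbol `Q`. -/
def Q13 : L13.Relations 1 := false

/-- The sentence `∃ x, P(x)`. -/
def sP13 : L13.Sentence := BoundedFormula.ex (P13.boundedFormula₁ (&0))

/-- The sentence `∃ x, Q(x)`. -/
def sQ13 : L13.Sentence := BoundedFormula.ex (Q13.boundedFormula₁ (&0))

/-- The theory with axioms `∃ x, P(x)` and `∃ x, Q(x)`. -/
def T13 : L13.Theory := {sP13, sQ13}

/-- `A` is the one-element structure whose element satisfies both `P` and `Q`. -/
instance : L13.Structure Unit where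
  funMap := fun f _ => f.elim
  RelMap := fun {n} r _ =>
    match n, r with
    | 1, _ => True

/-- `B` is the two-element structure in which the element `true` satisfies only `P` and
the element `false` satisfies only `Q`. -/
instance : L13.Structure Bool where
  funMap := fun f _ => f.elim
  RelMap := fun {n} r x =>
    match n, r with
    | 1, b => x 0 = b

/-- A structure is a model of `T13` iff each of `P` and `Q` holds of some element. -/
theorem models_T13_iff (M : Type*) [L13.Structure M] :
    M ⊨ T13 ↔ (∃ x : M, Structure.RelMap P13 ![x]) ∧ ∃ x : M, Structure.RelMap Q13 ![x] := by
  simp [T13, Theory.model_iff, Sentence.Realize, Formula.Realize, sP13, sQ13, Fin.snoc]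

/-- A homomorphism of `L13`-structures is a map preserving the unary relations. -/
def homOfUnary {M N : Type*} [L13.Structure M] [L13.Structure N] (f : M → N)
    (hf : ∀ (r : L13.Relations 1) (x : Fin 1 → M),
      Structure.RelMap r x → Structure.RelMap r (f ∘ x)) : M →[L13] N where
  toFun := f
  map_fun' := fun s _ => Empty.elim s
  map_rel' := fun {n} r x =>
    match n, r with
    | 1, r => hf r x
    | 0, r => Empty.elim r
    | _ + 2, r => Empty.elim r

/-- There are a language `L13` (two unary relation symbols `P`, `Q`), a theory `T13`
(axioms `∃x P(x)` and `∃x Q(x)`), and a finite model `A = Unit` of `T13` (its element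
satisfying both `P` and `Q`) such that `A` is i-minimal for `T13` (every injective
homomorphism from a model of `T13` into `A` is an isomorphism), but `A` is not a-minimal
for `T13`: the two-element model `B = Bool` (one element satisfying only `P`, the other
only `Q`) admits a homomorphism `B → A`, but there is no homomorphism `A → B`. -/
theorem stmt_13 :
    (Unit ⊨ T13) ∧ Finite Unit ∧
      (∀ (B : Type) [L13.Structure B], B ⊨ T13 →
        ∀ h : B →[L13] Unit, Function.Injective h →
          ∃ g : Unit →[L13] B, g.comp h = Hom.id L13 B ∧ h.comp g = Hom.id L13 Unit) ∧
      (Bool ⊨ T13) ∧ Nonempty (Bool →[L13] Unit) ∧ ¬ Nonempty (Unit →[L13] Bool) := by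
  refine ⟨(models_T13_iff _).2 ⟨⟨(), trivial⟩, ⟨(), trivial⟩⟩, inferInstance, ?_,
    (models_T13_iff _).2 ⟨⟨true, rfl⟩, ⟨false, rfl⟩⟩,
    ⟨homOfUnary (fun _ => ()) fun _ _ _ => trivial⟩, ?_⟩
  · intro B _ hB h hinj
    obtain ⟨⟨p, hp⟩, ⟨q, hq⟩⟩ := (models_T13_iff B).1 hB
    have hsub : ∀ x y : B, x = y := fun x y => hinj rfl
    refine ⟨homOfUnary (fun _ => p) ?_, Hom.ext fun x => hsub _ _, Hom.ext fun _ => rfl⟩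
    intro r x _
    cases r with
    | true => exact (congrArg (Structure.RelMap P13) (funext fun _ => hsub _ _)).mp hp
    | false => exact (congrArg (Structure.RelMap Q13) (funext fun _ => hsub _ _)).mp hq
  · rintro ⟨f⟩
    have hP : f () = true := f.map_rel P13 ![()] trivial
    have hQ : f () = false := f.map_rel Q13 ![()] trivial
    exact Bool.noConfusion (hP.symm.trans hQ)
end
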